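/- Theorem B: Let {f_k} be a C¹-uniformly equicontinuous and C¹-uniformly bounded sequence of C¹ maps f_k : I₀ → I₀ with p = sup_k #𝒞_k < ∞, and suppose there is λ > 0 and a set H ⊆ I₀ such that liminf_{n→∞} (1/n) log |Df^n(x)| > 2λ for every x ∈ H. Then there exists c > 0 such that for Lebesgue almost every x ∈ H, liminf_{n→∞} (1/n) Σ_{i=1}^n r_i(x) ≥ c. -/

import Mathlib

open Set MeasureTheory Filter

noncomputable section

/-- `comp f n = f_{n-1} ∘ ⋯ ∘ f_0`, with `comp f 0 = id`. -/
def comp (f : ℕ → ℝ → ℝ) : ℕ → ℝ → ℝ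
  | 0 => id
  | (n + 1) => f n ∘ comp f n

/-- The critical set `𝒞_k` of `f_k` inside the interval `I`. -/
def crit (f : ℕ → ℝ → ℝ) (I : Set ℝ) (k : ℕ) : Set ℝ :=
  {x ∈ I | deriv (f k) x = 0}

/-- `T f I i x`: the maximal (pre)interval in `I` containing `x` such that
`f^j` of it avoids `𝒞_j` for all `j < i`. -/
def T (f : ℕ → ℝ → ℝ) (I : Set ℝ) (i : ℕ) (x : ℝ) : Set ℝ :=
  ⋃₀ {S | S ⊆ I ∧ IsPreconnected S ∧ x ∈ S ∧
      ∀ j < i, ∀ y ∈ S, comp f j y ∉ crit f I j}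

/-- `r f I i x`: the minimum of the lengths of the images under `f^i` of the
two connected components of `T f I i x \ {x}`. -/
def r (f : ℕ → ℝ → ℝ) (I : Set ℝ) (i : ℕ) (x : ℝ) : ℝ :=
  min (Metric.diam (comp f i '' (T f I i x ∩ Iio x)))
      (Metric.diam (comp f i '' (T f I i x ∩ Ioi x)))


/-- `Dcomp f n x = ∏_{j<n} f_j'(f^j(x))`, the derivative of `f^n` at `x` by the chain rule. -/
def Dcomp (f : ℕ → ℝ → ℝ) (n : ℕ) (x : ℝ) : ℝ :=
  ∏ j ∈ Finset.range n, deriv (f j) (comp f j x)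

/-- `A_n(δ) = {x ∈ I : (1/n) Σ_{i=1}^n r_i(x) < δ², r_n(x) > 0}`. -/
def Aset (f : ℕ → ℝ → ℝ) (I : Set ℝ) (n : ℕ) (δ : ℝ) : Set ℝ :=
  {x ∈ I | (1 / (n : ℝ)) * ∑ i ∈ Finset.Icc 1 n, r f I i x < δ ^ 2 ∧ 0 < r f I n x}

/-- `Y_n(λ) = {x ∈ I : (1/n) log |Df^n(x)| > λ}`. -/
def Yset (f : ℕ → ℝ → ℝ) (I : Set ℝ) (n : ℕ) (lam : ℝ) : Set ℝ :=
  {x ∈ I | lam < (1 / (n : ℝ)) * Real.log |Dcomp f n x|}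

/-! Auxiliary material for the proof. -/

lemma comp_mapsTo {f : ℕ → ℝ → ℝ} {a b : ℝ} (hmaps : ∀ k, MapsTo (f k) (Icc a b) (Icc a b))
    (n : ℕ) {x : ℝ} (hx : x ∈ Icc a b) : comp f n x ∈ Icc a b := by
  induction n with
  | zero => simpa [comp] using hx
  | succ n ih => exact hmaps n ih

lemma comp_hasDerivAt {f : ℕ → ℝ → ℝ} (hC1 : ∀ k, ContDiff ℝ 1 (f k)) (n : ℕ) (x : ℝ) :
    HasDerivAt (comp f n) (Dcomp f n x) x := by
  induction n with
  | zero => simpa [comp, Dcomp] using hasDerivAt_id x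
  | succ n ih =>
    have h : HasDerivAt (f n) (deriv (f n) (comp f n x)) (comp f n x) :=
      ((hC1 n).differentiable (by norm_num) _).hasDerivAt
    have := h.comp x ih
    simp only [comp, Dcomp, Finset.prod_range_succ]
    rw [mul_comm]
    exact this

lemma comp_continuous {f : ℕ → ℝ → ℝ} (hC1 : ∀ k, ContDiff ℝ 1 (f k)) (n : ℕ) :
    Continuous (comp f n) :=
  continuous_iff_continuousAt.2 fun x => (comp_hasDerivAt hC1 n x).continuousAt

lemma Dcomp_continuous {f : ℕ → ℝ → ℝ} (hC1 : ∀ k, ContDiff ℝ 1 (f k)) (n : ℕ) :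
    Continuous (Dcomp f n) := by
  unfold Dcomp
  refine continuous_finsetProd _ fun j _ => ?_
  exact ((hC1 j).continuous_deriv le_rfl).comp (comp_continuous hC1 j)

lemma Dcomp_ne_zero_iff {f : ℕ → ℝ → ℝ} {n : ℕ} {x : ℝ} :
    Dcomp f n x ≠ 0 ↔ ∀ j < n, deriv (f j) (comp f j x) ≠ 0 := by
  simp [Dcomp, Finset.prod_ne_zero_iff]

lemma Dcomp_ne_zero_mono {f : ℕ → ℝ → ℝ} {m n : ℕ} (h : m ≤ n) {x : ℝ}
    (hx : Dcomp f n x ≠ 0) : Dcomp f m x ≠ 0 :=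
  Dcomp_ne_zero_iff.2 fun j hj => Dcomp_ne_zero_iff.1 hx j (hj.trans_le h)

/-- `x` and `y` lie in the same branch of `f^m`. -/
def Same (f : ℕ → ℝ → ℝ) (m : ℕ) (x y : ℝ) : Prop := ∀ z ∈ uIcc x y, Dcomp f m z ≠ 0

lemma Same.symm' {f : ℕ → ℝ → ℝ} {m : ℕ} {x y : ℝ} (h : Same f m x y) : Same f m y x := by
  unfold Same at *
  rwa [uIcc_comm]

lemma Same.trans' {f : ℕ → ℝ → ℝ} {m : ℕ} {x y z : ℝ} (h : Same f m x y) (h' : Same f m y z) :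
    Same f m x z := by
  intro w hw
  rcases uIcc_subset_uIcc_union_uIcc (b := y) hw with hw | hw
  · exact h w hw
  · exact h' w hw

lemma Same.ne {f : ℕ → ℝ → ℝ} (hC1 : ∀ k, ContDiff ℝ 1 (f k)) {m : ℕ} {x y : ℝ}
    (h : Same f m x y) (hxy : comp f m x = comp f m y) : x = y := by
  by_contra hne
  wlog hlt : x < y generalizing x y
  · exact this h.symm' hxy.symm (Ne.symm hne) (lt_of_le_of_ne (not_lt.1 hlt) (Ne.symm hne))
  obtain ⟨c, hc, hc0⟩ := exists_hasDerivAt_eq_zero hlt (comp_continuous hC1 m).continuousOn hxy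
    (fun z _ => comp_hasDerivAt hC1 m z)
  exact h c (by rw [uIcc_of_le hlt.le]; exact Ioo_subset_Icc_self hc) hc0

/-- `E` meets at most `N` branches of `f^m`. -/
def Cov (f : ℕ → ℝ → ℝ) (m : ℕ) (E : Set ℝ) (N : ℕ) : Prop :=
  ∃ c : ℝ → ℕ, (∀ x ∈ E, c x < N) ∧ ∀ x ∈ E, ∀ y ∈ E, c x = c y → Same f m x y

lemma Cov.mono {f : ℕ → ℝ → ℝ} {m : ℕ} {E E' : Set ℝ} {N N' : ℕ} (h : Cov f m E N)
    (hE : E' ⊆ E) (hN : N ≤ N') : Cov f m E' N' := by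
  obtain ⟨c, h1, h2⟩ := h
  exact ⟨c, fun x hx => (h1 x (hE hx)).trans_le hN, fun x hx y hy => h2 x (hE hx) y (hE hy)⟩

lemma Cov.union {f : ℕ → ℝ → ℝ} {m : ℕ} {E E' : Set ℝ} {N N' : ℕ} (h : Cov f m E N)
    (h' : Cov f m E' N') : Cov f m (E ∪ E') (N + N') := by
  classical
  obtain ⟨c, h1, h2⟩ := h
  obtain ⟨d, h3, h4⟩ := h'
  refine ⟨fun x => if x ∈ E then c x else N + d x, ?_, ?_⟩
  · intro x hx
    by_cases hxE : x ∈ E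
    · have := h1 x hxE
      simp only [hxE, if_true]; omega
    · have := h3 x (hx.resolve_left hxE)
      simp only [hxE, if_false]; omega
  · intro x hx y hy hc
    by_cases hxE : x ∈ E <;> by_cases hyE : y ∈ E <;> simp only [hxE, hyE, if_true, if_false] at hc
    · exact h2 x hxE y hyE hc
    · have := h1 x hxE; omega
    · have := h1 y hyE; omega
    · exact h4 x (hx.resolve_left hxE) y (hy.resolve_left hyE) (by omega)

/-- Refinement by an extra code with `K` values. -/
lemma Cov.refine {f : ℕ → ℝ → ℝ} {m m' : ℕ} {E : Set ℝ} {N K : ℕ} (h : Cov f m E N)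
    (d : ℝ → ℕ) (hd : ∀ x ∈ E, d x < K)
    (hs : ∀ x ∈ E, ∀ y ∈ E, x < y → Same f m x y → d x = d y → Same f m' x y)
    (hD : ∀ x ∈ E, Dcomp f m' x ≠ 0) :
    Cov f m' E (K * N) := by
  obtain ⟨c, h1, h2⟩ := h
  refine ⟨fun x => d x + K * c x, ?_, ?_⟩
  · intro x hx
    have e1 := h1 x hx
    have e2 := hd x hx
    calc d x + K * c x < K + K * c x := by omega
      _ = K * (c x + 1) := by ring
      _ ≤ K * N := Nat.mul_le_mul_left _ e1
  · intro x hx y hy hc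
    have ex := hd x hx
    have ey := hd y hy
    have hK : 0 < K := by omega
    have h3 : d x = d y := by
      have := congrArg (· % K) hc
      simpa [Nat.add_mul_mod_self_left, Nat.mod_eq_of_lt ex, Nat.mod_eq_of_lt ey] using this
    have h4 : c x = c y := by
      have : K * c x = K * c y := by simp only [] at hc; omega
      exact Nat.eq_of_mul_eq_mul_left hK this
    have hS := h2 x hx y hy h4
    rcases lt_trichotomy x y with hlt | heq | hlt
    · exact hs x hx y hy hlt hS h3
    · subst heq
      intro z hz
      simp only [uIcc_self, mem_singleton_iff] at hz
      subst hz
      exact hD z hx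
    · exact (hs y hy x hx hlt hS.symm' h3.symm).symm'

lemma Cov.step {f : ℕ → ℝ → ℝ} {a b : ℝ} {p : ℕ} (hC1 : ∀ k, ContDiff ℝ 1 (f k))
    (hmaps : ∀ k, MapsTo (f k) (Icc a b) (Icc a b))
    (hcrit : ∀ k, (crit f (Icc a b) k).Finite ∧ (crit f (Icc a b) k).ncard ≤ p)
    {m : ℕ} {E : Set ℝ} {N : ℕ} (h : Cov f m E N) (hE : E ⊆ Icc a b)
    (hD : ∀ x ∈ E, Dcomp f (m + 1) x ≠ 0) : Cov f (m + 1) E ((p + 1) * N) := by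
  let Z : ℝ → Set ℝ := fun x => {z ∈ Icc a b | Same f m x z ∧ comp f m z ∈ crit f (Icc a b) m}
  have hinj : ∀ x, InjOn (comp f m) (Z x) := by
    intro x z hz w hw hzw
    exact Same.ne hC1 (hz.2.1.symm'.trans' hw.2.1) hzw
  have hmt : ∀ x, MapsTo (comp f m) (Z x) (crit f (Icc a b) m) := fun x z hz => hz.2.2
  have hfin : ∀ x, (Z x).Finite := fun x => Set.Finite.of_injOn (hmt x) (hinj x) (hcrit m).1
  have hcard : ∀ x, (Z x).ncard ≤ p := fun x =>
    (Set.ncard_le_ncard_of_injOn (comp f m) (hmt x) (hinj x) (hcrit m).1).trans (hcrit m).2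
  refine h.refine (fun x => (Z x ∩ Iio x).ncard) ?_ ?_ hD
  · intro x _
    exact Nat.lt_succ_of_le ((Set.ncard_le_ncard inter_subset_left (hfin x)).trans (hcard x))
  · intro x hx y hy hlt hS hxy
    have hZ : Z x = Z y := by
      ext z
      exact ⟨fun hz => ⟨hz.1, hS.symm'.trans' hz.2.1, hz.2.2⟩,
        fun hz => ⟨hz.1, hS.trans' hz.2.1, hz.2.2⟩⟩
    rw [← hZ] at hxy
    have hsub : Z x ∩ Iio x ⊆ Z x ∩ Iio y :=
      inter_subset_inter_right _ (Iio_subset_Iio hlt.le)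
    have heq := Set.eq_of_subset_of_ncard_le hsub hxy.ge ((hfin x).inter_of_left _)
    intro z hz
    have hz' := hz
    rw [uIcc_of_le hlt.le] at hz
    rcases eq_or_lt_of_le hz.2 with rfl | hzy
    · exact hD z hy
    refine Dcomp_ne_zero_iff.2 fun j hj => ?_
    rcases Nat.lt_succ_iff_lt_or_eq.1 hj with hj | rfl
    · exact Dcomp_ne_zero_iff.1 (hS z hz') j hj
    · intro h0
      have hzI : z ∈ Icc a b := ⟨(hE hx).1.trans hz.1, hz.2.trans (hE hy).2⟩
      have hzZ : z ∈ Z x ∩ Iio y := by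
        refine ⟨⟨hzI, ?_, comp_mapsTo hmaps _ hzI, h0⟩, hzy⟩
        intro w hw
        refine hS w (uIcc_subset_uIcc_left hz' hw)
      rw [← heq] at hzZ
      exact absurd hzZ.2 (not_lt.2 hz.1)

lemma Cov.steps {f : ℕ → ℝ → ℝ} {a b : ℝ} {p : ℕ} (hC1 : ∀ k, ContDiff ℝ 1 (f k))
    (hmaps : ∀ k, MapsTo (f k) (Icc a b) (Icc a b))
    (hcrit : ∀ k, (crit f (Icc a b) k).Finite ∧ (crit f (Icc a b) k).ncard ≤ p)
    {m : ℕ} {E : Set ℝ} {N : ℕ} (h : Cov f m E N) (hE : E ⊆ Icc a b) (s : ℕ)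
    (hD : ∀ x ∈ E, Dcomp f (m + s) x ≠ 0) : Cov f (m + s) E ((p + 1) ^ s * N) := by
  induction s with
  | zero => simpa using h
  | succ s ih =>
    have := (ih fun x hx => Dcomp_ne_zero_mono (by omega) (hD x hx)).step hC1 hmaps hcrit hE hD
    refine this.mono subset_rfl (le_of_eq ?_)
    ring

lemma lip {f : ℕ → ℝ → ℝ} {a b Γ : ℝ} (hC1 : ∀ k, ContDiff ℝ 1 (f k))
    (hbdd : ∀ k, ∀ x ∈ Icc a b, |deriv (f k) x| ≤ Γ) (k : ℕ) {x y : ℝ}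
    (hx : x ∈ Icc a b) (hy : y ∈ Icc a b) : |f k x - f k y| ≤ Γ * |x - y| := by
  have := (convex_Icc a b).norm_image_sub_le_of_norm_deriv_le (f := f k) (C := Γ)
    (fun z _ => (hC1 k).differentiable (by norm_num) z) (fun z hz => hbdd k z hz) hy hx
  simpa using this

lemma lips {f : ℕ → ℝ → ℝ} {a b Γ : ℝ} (hC1 : ∀ k, ContDiff ℝ 1 (f k))
    (hmaps : ∀ k, MapsTo (f k) (Icc a b) (Icc a b)) (hΓ : 1 ≤ Γ)
    (hbdd : ∀ k, ∀ x ∈ Icc a b, |deriv (f k) x| ≤ Γ) (m s : ℕ) {x y : ℝ}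
    (hx : x ∈ Icc a b) (hy : y ∈ Icc a b) :
    |comp f (m + s) x - comp f (m + s) y| ≤ Γ ^ s * |comp f m x - comp f m y| := by
  induction s with
  | zero => simp
  | succ s ih =>
    calc _ ≤ Γ * |comp f (m + s) x - comp f (m + s) y| :=
          lip hC1 hbdd (m + s) (comp_mapsTo hmaps _ hx) (comp_mapsTo hmaps _ hy)
      _ ≤ Γ * (Γ ^ s * |comp f m x - comp f m y|) := by gcongr
      _ = _ := by ring

/-- A good block starting at time `m`. -/
def Good (f : ℕ → ℝ → ℝ) (I : Set ℝ) (M : ℕ) (δ ζ : ℝ) (m : ℕ) (x : ℝ) : Prop :=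
  r f I m x < δ ∧ ∀ i, m ≤ i → i < m + M → ζ ≤ |deriv (f i) (comp f i x)|

lemma good_near {f : ℕ → ℝ → ℝ} {a b Γ ζ ε δ : ℝ} {M : ℕ} (hC1 : ∀ k, ContDiff ℝ 1 (f k))
    (hmaps : ∀ k, MapsTo (f k) (Icc a b) (Icc a b)) (hΓ : 1 ≤ Γ)
    (hbdd : ∀ k, ∀ x ∈ Icc a b, |deriv (f k) x| ≤ Γ)
    (hε : ∀ k, ∀ x ∈ Icc a b, ∀ y ∈ Icc a b,
      |x - y| < ε → |deriv (f k) x - deriv (f k) y| < ζ)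
    (hδ : Γ ^ M * δ ≤ ε) {m : ℕ} {x z : ℝ} (hx : x ∈ Icc a b) (hz : z ∈ Icc a b)
    (hg : ∀ i, m ≤ i → i < m + M → ζ ≤ |deriv (f i) (comp f i x)|)
    (hxz : |comp f m x - comp f m z| < δ) (hD : Dcomp f m z ≠ 0) : Dcomp f (m + M) z ≠ 0 := by
  refine Dcomp_ne_zero_iff.2 fun j hj => ?_
  rcases lt_or_ge j m with hjm | hjm
  · exact Dcomp_ne_zero_iff.1 hD j hjm
  obtain ⟨s, rfl⟩ := Nat.exists_eq_add_of_le hjm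
  intro h0
  have h1 := lips hC1 hmaps hΓ hbdd m s hx hz
  have h2 : |comp f (m + s) x - comp f (m + s) z| < ε := by
    refine lt_of_le_of_lt h1 (lt_of_lt_of_le ?_ hδ)
    have hp : Γ ^ s ≤ Γ ^ M := pow_le_pow_right₀ hΓ (by omega)
    have hp' : 0 < Γ ^ M := by positivity
    calc Γ ^ s * |comp f m x - comp f m z| ≤ Γ ^ M * |comp f m x - comp f m z| := by gcongr
      _ < Γ ^ M * δ := by gcongr
  have h3 := hε (m + s) _ (comp_mapsTo hmaps _ hx) _ (comp_mapsTo hmaps _ hz) h2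
  rw [h0, sub_zero] at h3
  exact absurd (hg (m + s) hjm hj) (not_le.2 h3)

lemma mem_T {f : ℕ → ℝ → ℝ} {a b : ℝ} {m : ℕ} {x y z : ℝ} (hx : x ∈ Icc a b) (hy : y ∈ Icc a b)
    (h : Same f m x y) (hz : z ∈ uIcc x y) : z ∈ T f (Icc a b) m x := by
  refine mem_sUnion.2 ⟨uIcc x y, ⟨ordConnected_Icc.uIcc_subset hx hy, isPreconnected_uIcc,
    left_mem_uIcc, ?_⟩, hz⟩
  intro j hj w hw hc
  exact Dcomp_ne_zero_iff.1 (h w hw) j hj hc.2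

lemma T_sub {f : ℕ → ℝ → ℝ} {I : Set ℝ} {m : ℕ} {x : ℝ} : T f I m x ⊆ I :=
  sUnion_subset fun _ hS => hS.1

lemma img_bdd {f : ℕ → ℝ → ℝ} {a b : ℝ} (hmaps : ∀ k, MapsTo (f k) (Icc a b) (Icc a b))
    (m : ℕ) (x : ℝ) (S : Set ℝ) : comp f m '' (T f (Icc a b) m x ∩ S) ⊆ Icc a b := by
  rintro _ ⟨y, hy, rfl⟩
  exact comp_mapsTo hmaps m (T_sub hy.1)

lemma r_nonneg {f : ℕ → ℝ → ℝ} {I : Set ℝ} {m : ℕ} {x : ℝ} : 0 ≤ r f I m x :=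
  le_min Metric.diam_nonneg Metric.diam_nonneg

lemma r_le {f : ℕ → ℝ → ℝ} {a b : ℝ} (hab : a ≤ b)
    (hmaps : ∀ k, MapsTo (f k) (Icc a b) (Icc a b))
    (m : ℕ) (x : ℝ) : r f (Icc a b) m x ≤ b - a := by
  refine (min_le_left _ _).trans ?_
  rw [← Real.diam_Icc hab]
  exact Metric.diam_mono (img_bdd hmaps m x _) (Metric.isBounded_Icc a b)

lemma Cov.good {f : ℕ → ℝ → ℝ} {a b Γ ζ ε δ : ℝ} {M : ℕ} (hC1 : ∀ k, ContDiff ℝ 1 (f k))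
    (hmaps : ∀ k, MapsTo (f k) (Icc a b) (Icc a b)) (hΓ : 1 ≤ Γ)
    (hbdd : ∀ k, ∀ x ∈ Icc a b, |deriv (f k) x| ≤ Γ)
    (hε : ∀ k, ∀ x ∈ Icc a b, ∀ y ∈ Icc a b,
      |x - y| < ε → |deriv (f k) x - deriv (f k) y| < ζ)
    (hδ : Γ ^ M * δ ≤ ε) {m : ℕ} {E : Set ℝ} {N : ℕ} (h : Cov f m E N) (hE : E ⊆ Icc a b)
    (hD : ∀ x ∈ E, Dcomp f (m + M) x ≠ 0)
    (hg : ∀ x ∈ E, Good f (Icc a b) M δ ζ m x) : Cov f (m + M) E (2 * N) := by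
  classical
  refine h.refine (fun x =>
    if Metric.diam (comp f m '' (T f (Icc a b) m x ∩ Iio x)) < δ then 0 else 1) ?_ ?_ hD
  · intro x _
    split_ifs <;> omega
  · intro x hx y hy hlt hS hxy z hz
    have hz' := hz
    rw [uIcc_of_le hlt.le] at hz
    have hzI : z ∈ Icc a b := ⟨(hE hx).1.trans hz.1, hz.2.trans (hE hy).2⟩
    by_cases hside : Metric.diam (comp f m '' (T f (Icc a b) m y ∩ Iio y)) < δ
    · rcases eq_or_lt_of_le hz.2 with rfl | hzy
      · exact hD z hy
      refine good_near hC1 hmaps hΓ hbdd hε hδ (hE hx) hzI (hg x hx).2 ?_ (hS z hz')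
      refine lt_of_le_of_lt ?_ hside
      rw [← Real.dist_eq]
      refine Metric.dist_le_diam_of_mem ((Metric.isBounded_Icc a b).subset (img_bdd hmaps m y _)) ?_ ?_
      · exact mem_image_of_mem _ ⟨mem_T (hE hy) (hE hx) hS.symm' right_mem_uIcc, hlt⟩
      · exact mem_image_of_mem _ ⟨mem_T (hE hy) (hE hx) hS.symm' (by rwa [uIcc_comm]), hzy⟩
    · have hside' : ¬ Metric.diam (comp f m '' (T f (Icc a b) m x ∩ Iio x)) < δ := by
        intro hc
        rw [if_pos hc, if_neg hside] at hxy
        omega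
      have hr : Metric.diam (comp f m '' (T f (Icc a b) m x ∩ Ioi x)) < δ :=
        (min_lt_iff.1 (hg x hx).1).resolve_left hside'
      rcases eq_or_lt_of_le hz.1 with rfl | hxz
      · exact hD x hx
      refine good_near hC1 hmaps hΓ hbdd hε hδ (hE hy) hzI (hg y hy).2 ?_ (hS z hz')
      refine lt_of_le_of_lt ?_ hr
      rw [← Real.dist_eq]
      refine Metric.dist_le_diam_of_mem ((Metric.isBounded_Icc a b).subset (img_bdd hmaps m x _)) ?_ ?_
      · exact mem_image_of_mem _ ⟨mem_T (hE hx) (hE hy) hS right_mem_uIcc, hlt⟩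
      · exact mem_image_of_mem _ ⟨mem_T (hE hx) (hE hy) hS hz', hxz⟩

open Classical in
/-- The indices of bad blocks among the first `q`. -/
def badBlocks (f : ℕ → ℝ → ℝ) (I : Set ℝ) (M : ℕ) (δ ζ : ℝ) (q : ℕ) (x : ℝ) : Finset ℕ :=
  (Finset.range q).filter fun j => ¬ Good f I M δ ζ (j * M) x

lemma Cov.count {f : ℕ → ℝ → ℝ} {a b Γ ζ ε δ : ℝ} {M p : ℕ} (hC1 : ∀ k, ContDiff ℝ 1 (f k))
    (hmaps : ∀ k, MapsTo (f k) (Icc a b) (Icc a b)) (hΓ : 1 ≤ Γ)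
    (hbdd : ∀ k, ∀ x ∈ Icc a b, |deriv (f k) x| ≤ Γ)
    (hcrit : ∀ k, (crit f (Icc a b) k).Finite ∧ (crit f (Icc a b) k).ncard ≤ p)
    (hε : ∀ k, ∀ x ∈ Icc a b, ∀ y ∈ Icc a b,
      |x - y| < ε → |deriv (f k) x - deriv (f k) y| < ζ)
    (hδ : Γ ^ M * δ ≤ ε) (q : ℕ) : ∀ k : ℕ,
    Cov f (q * M) {x ∈ Icc a b | Dcomp f (q * M) x ≠ 0 ∧
      (badBlocks f (Icc a b) M δ ζ q x).card ≤ k} (3 ^ q * ((p + 1) ^ M) ^ k) := by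
  classical
  induction q with
  | zero =>
    intro k
    refine ⟨fun _ => 0, fun x _ => by positivity, fun x _ y _ _ z _ => by simp [Dcomp]⟩
  | succ q ih =>
    intro k
    have hq : (q + 1) * M = q * M + M := by ring
    rw [hq]
    have hgood : Cov f (q * M + M) {x ∈ Icc a b | Dcomp f (q * M + M) x ≠ 0 ∧
        (badBlocks f (Icc a b) M δ ζ q x).card ≤ k ∧ Good f (Icc a b) M δ ζ (q * M) x}
        (2 * (3 ^ q * ((p + 1) ^ M) ^ k)) := by
      refine Cov.good hC1 hmaps hΓ hbdd hε hδ ((ih k).mono ?_ le_rfl) ?_ ?_ ?_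
      · exact fun x hx => ⟨hx.1, Dcomp_ne_zero_mono (by omega) hx.2.1, hx.2.2.1⟩
      · exact fun x hx => hx.1
      · exact fun x hx => hx.2.1
      · exact fun x hx => hx.2.2.2
    have hsplit : ∀ x, ¬ Good f (Icc a b) M δ ζ (q * M) x →
        (badBlocks f (Icc a b) M δ ζ (q + 1) x).card =
          (badBlocks f (Icc a b) M δ ζ q x).card + 1 := by
      intro x hx
      unfold badBlocks
      rw [Finset.range_add_one, Finset.filter_insert, if_pos hx, Finset.card_insert_of_notMem]
      simp
    have hle : ∀ x, (badBlocks f (Icc a b) M δ ζ q x).card ≤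
        (badBlocks f (Icc a b) M δ ζ (q + 1) x).card := by
      intro x
      exact Finset.card_le_card (Finset.filter_subset_filter _ (by simp))
    rcases k with _ | k
    · refine hgood.mono ?_ ?_
      · rintro x ⟨h1, h2, h3⟩
        refine ⟨h1, h2, (hle x).trans h3, ?_⟩
        by_contra hb
        have := hsplit x hb
        omega
      · rw [pow_succ]; simp; omega
    · have hbad := Cov.steps hC1 hmaps hcrit (E := {x ∈ Icc a b | Dcomp f (q * M + M) x ≠ 0 ∧
        (badBlocks f (Icc a b) M δ ζ q x).card ≤ k}) ((ih k).mono
          (fun x hx => ⟨hx.1, Dcomp_ne_zero_mono (by omega) hx.2.1, hx.2.2⟩) le_rfl)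
          (fun x hx => hx.1) M (fun x hx => hx.2.1)
      refine (hgood.union hbad).mono ?_ (le_of_eq ?_)
      · rintro x ⟨h1, h2, h3⟩
        by_cases hb : Good f (Icc a b) M δ ζ (q * M) x
        · exact Or.inl ⟨h1, h2, (hle x).trans h3, hb⟩
        · refine Or.inr ⟨h1, h2, ?_⟩
          have := hsplit x hb
          omega
      · ring

lemma Cov.measure {f : ℕ → ℝ → ℝ} {a b t : ℝ} (hC1 : ∀ k, ContDiff ℝ 1 (f k))
    (hmaps : ∀ k, MapsTo (f k) (Icc a b) (Icc a b)) {n N : ℕ} {E : Set ℝ}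
    (h : Cov f n E N) (hE : E ⊆ Icc a b) (ht : 0 < t) (hY : ∀ x ∈ E, t ≤ |Dcomp f n x|) :
    volume E ≤ N * ENNReal.ofReal ((b - a) / t) := by
  obtain ⟨c, h1, h2⟩ := h
  have hcov : E ⊆ ⋃ i ∈ Finset.range N, {x ∈ E | c x = i} := by
    intro x hx
    simp only [mem_iUnion, Finset.mem_range]
    exact ⟨c x, h1 x hx, hx, rfl⟩
  have hone : ∀ i, volume {x ∈ E | c x = i} ≤ ENNReal.ofReal ((b - a) / t) := by
    intro i
    rcases Set.eq_empty_or_nonempty {x ∈ E | c x = i} with he | ⟨x0, hx0⟩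
    · rw [he]; simp
    let C : Set ℝ := {y | Same f n x0 y}
    have hC : OrdConnected C := by
      refine ⟨fun y hy z hz w hw => ?_⟩
      have hyz : Same f n y z := (Same.symm' hy).trans' hz
      refine Same.trans' hy fun v hv => hyz v ?_
      exact uIcc_subset_uIcc_left (Icc_subset_uIcc hw) hv
    let S : Set ℝ := (Icc a b ∩ C) ∩ {y | t ≤ |Dcomp f n y|}
    have hS : MeasurableSet S := (measurableSet_Icc.inter hC.measurableSet).inter
      (measurableSet_le measurable_const (Dcomp_continuous hC1 n).abs.measurable)
    have hsub : {x ∈ E | c x = i} ⊆ S := fun x hx =>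
      ⟨⟨hE hx.1, h2 x0 hx0.1 x hx.1 (hx0.2.trans hx.2.symm)⟩, hY x hx.1⟩
    refine (measure_mono hsub).trans ?_
    have hinj : InjOn (comp f n) S := fun y hy z hz hyz =>
      Same.ne hC1 ((Same.symm' hy.1.2).trans' hz.1.2) hyz
    have himg := lintegral_abs_det_fderiv_eq_addHaar_image volume hS
      (fun y _ => (comp_hasDerivAt hC1 n y).hasFDerivAt.hasFDerivWithinAt) hinj
    have himg2 : volume (comp f n '' S) ≤ ENNReal.ofReal (b - a) := by
      rw [← Real.volume_Icc]
      refine measure_mono ?_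
      rintro _ ⟨y, hy, rfl⟩
      exact comp_mapsTo hmaps n hy.1.1
    rw [← himg] at himg2
    have hlow : ENNReal.ofReal t * volume S ≤ ENNReal.ofReal (b - a) := by
      refine le_trans ?_ himg2
      rw [← setLIntegral_const]
      refine setLIntegral_mono' hS fun y hy => ?_
      refine ENNReal.ofReal_le_ofReal ?_
      simpa using hy.2
    rw [ENNReal.ofReal_div_of_pos ht, ENNReal.le_div_iff_mul_le (by simp [ht]) (by simp), mul_comm]
    exact hlow
  calc volume E ≤ volume (⋃ i ∈ Finset.range N, {x ∈ E | c x = i}) := measure_mono hcov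
    _ ≤ ∑ i ∈ Finset.range N, volume {x ∈ E | c x = i} := measure_biUnion_finset_le _ _
    _ ≤ ∑ i ∈ Finset.range N, ENNReal.ofReal ((b - a) / t) := Finset.sum_le_sum fun i _ => hone i
    _ = _ := by simp

lemma bad_count {f : ℕ → ℝ → ℝ} {a b Γ ζ δ η : ℝ} {M n : ℕ} (hM : 0 < M)
    (hmaps : ∀ k, MapsTo (f k) (Icc a b) (Icc a b)) (hΓ : 1 ≤ Γ)
    (hbdd : ∀ k, ∀ x ∈ Icc a b, |deriv (f k) x| ≤ Γ) (hδ : 0 < δ) (hη : 0 < η)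
    (hζ : ζ = Real.exp (-((Real.log Γ + 1) / η))) {x : ℝ} (hx : x ∈ Icc a b)
    (hr : ∑ i ∈ Finset.Icc 1 n, r f (Icc a b) i x ≤ δ ^ 2 * n)
    (hD : Dcomp f n x ≠ 0) (hl : 0 ≤ Real.log |Dcomp f n x|) :
    ((badBlocks f (Icc a b) M δ ζ (n / M) x).card : ℝ) ≤ (δ + η) * n + 1 := by
  classical
  set A := (Finset.Icc 1 n).filter fun i => δ ≤ r f (Icc a b) i x with hA
  set B := (Finset.range n).filter fun i => |deriv (f i) (comp f i x)| < ζ with hB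
  have hG : 0 ≤ Real.log Γ := Real.log_nonneg hΓ
  have hAc : (A.card : ℝ) ≤ δ * n := by
    have h1 : A.card * δ ≤ ∑ i ∈ A, r f (Icc a b) i x := by
      rw [← nsmul_eq_mul]
      exact Finset.card_nsmul_le_sum _ _ _ fun i hi => (Finset.mem_filter.1 hi).2
    have h2 : ∑ i ∈ A, r f (Icc a b) i x ≤ ∑ i ∈ Finset.Icc 1 n, r f (Icc a b) i x :=
      Finset.sum_le_sum_of_subset_of_nonneg (Finset.filter_subset _ _) fun _ _ _ => r_nonneg
    have h3 : A.card * δ ≤ (δ * n) * δ := by nlinarith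
    exact le_of_mul_le_mul_right h3 hδ
  have hBc : (B.card : ℝ) ≤ η * n := by
    have h1 : Real.log |Dcomp f n x| =
        ∑ i ∈ Finset.range n, Real.log |deriv (f i) (comp f i x)| := by
      unfold Dcomp
      rw [Finset.abs_prod, Real.log_prod]
      intro i hi
      exact abs_ne_zero.2 (Dcomp_ne_zero_iff.1 hD i (Finset.mem_range.1 hi))
    have h2 : ∑ i ∈ Finset.range n, Real.log |deriv (f i) (comp f i x)| ≤
        ∑ i ∈ Finset.range n, (Real.log Γ +
          if |deriv (f i) (comp f i x)| < ζ then -((Real.log Γ + 1) / η) else 0) := by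
      refine Finset.sum_le_sum fun i hi => ?_
      have hpos : 0 < |deriv (f i) (comp f i x)| :=
        abs_pos.2 (Dcomp_ne_zero_iff.1 hD i (Finset.mem_range.1 hi))
      split_ifs with hlt
      · have := Real.log_le_log hpos hlt.le
        rw [hζ, Real.log_exp] at this
        linarith
      · have := Real.log_le_log hpos (hbdd i _ (comp_mapsTo hmaps i hx))
        linarith
    rw [Finset.sum_add_distrib, ← Finset.sum_filter] at h2
    simp only [Finset.sum_const, Finset.card_range, nsmul_eq_mul] at h2
    rw [← hB] at h2
    have h3 : B.card * ((Real.log Γ + 1) / η) ≤ n * Real.log Γ := by linarith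
    have h4 : (B.card : ℝ) * (Real.log Γ + 1) ≤ (η * n) * (Real.log Γ + 1) := by
      have h5 : (B.card : ℝ) * (Real.log Γ + 1) = η * (B.card * ((Real.log Γ + 1) / η)) := by
        field_simp
      rw [h5]
      have hn : (0 : ℝ) ≤ n := Nat.cast_nonneg n
      nlinarith [mul_le_mul_of_nonneg_left h3 hη.le]
    exact le_of_mul_le_mul_right h4 (by linarith)
  have hsub : badBlocks f (Icc a b) M δ ζ (n / M) x ⊆
      insert 0 (A.image (· / M)) ∪ B.image (· / M) := by
    intro j hj
    obtain ⟨hj1, hj2⟩ := Finset.mem_filter.1 hj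
    have hj1 : j < n / M := Finset.mem_range.1 hj1
    have hj3 : (j + 1) * M ≤ n := (Nat.le_div_iff_mul_le hM).1 hj1
    rw [add_mul, one_mul] at hj3
    simp only [Good, not_and_or, not_lt, not_forall, not_le] at hj2
    rcases hj2 with h | ⟨i, h1, h2, h3⟩
    · refine Finset.mem_union_left _ ?_
      rcases Nat.eq_zero_or_pos j with rfl | hpos
      · exact Finset.mem_insert_self _ _
      · refine Finset.mem_insert_of_mem (Finset.mem_image.2 ⟨j * M, ?_, Nat.mul_div_cancel _ hM⟩)
        refine Finset.mem_filter.2 ⟨Finset.mem_Icc.2 ⟨Nat.mul_pos hpos hM, by omega⟩, h⟩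
    · refine Finset.mem_union_right _ (Finset.mem_image.2 ⟨i, ?_, ?_⟩)
      · exact Finset.mem_filter.2 ⟨Finset.mem_range.2 (by omega), h3⟩
      · refine Nat.div_eq_of_lt_le h1 ?_
        rw [add_mul, one_mul]; exact h2
  have hc : (badBlocks f (Icc a b) M δ ζ (n / M) x).card ≤ A.card + 1 + B.card := by
    refine (Finset.card_le_card hsub).trans ((Finset.card_union_le _ _).trans ?_)
    have e1 : (insert 0 (A.image (· / M))).card ≤ (A.image (· / M)).card + 1 :=
      Finset.card_insert_le _ _
    have e2 : (A.image (· / M)).card ≤ A.card := Finset.card_image_le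
    have e3 : (B.image (· / M)).card ≤ B.card := Finset.card_image_le
    omega
  have hc' : ((badBlocks f (Icc a b) M δ ζ (n / M) x).card : ℝ) ≤ A.card + 1 + B.card := by
    exact_mod_cast hc
  nlinarith

/-- The bad set at time `n`. -/
def Bset (f : ℕ → ℝ → ℝ) (I : Set ℝ) (lam δ : ℝ) (n : ℕ) : Set ℝ :=
  {x ∈ I | (1 / (n : ℝ)) * ∑ i ∈ Finset.Icc 1 n, r f I i x < δ ^ 2 ∧
    lam < (1 / (n : ℝ)) * Real.log |Dcomp f n x|}

lemma Bset_measure {f : ℕ → ℝ → ℝ} {a b Γ ζ ε δ η lam : ℝ} {M p : ℕ} (hM : 0 < M) (hab : a ≤ b)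
    (hC1 : ∀ k, ContDiff ℝ 1 (f k)) (hlam : 0 < lam)
    (hmaps : ∀ k, MapsTo (f k) (Icc a b) (Icc a b)) (hΓ : 1 ≤ Γ)
    (hbdd : ∀ k, ∀ x ∈ Icc a b, |deriv (f k) x| ≤ Γ)
    (hcrit : ∀ k, (crit f (Icc a b) k).Finite ∧ (crit f (Icc a b) k).ncard ≤ p)
    (hδ : 0 < δ) (hη : 0 < η)
    (hζ : ζ = Real.exp (-((Real.log Γ + 1) / η)))
    (hε : ∀ k, ∀ x ∈ Icc a b, ∀ y ∈ Icc a b,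
      |x - y| < ε → |deriv (f k) x - deriv (f k) y| < ζ)
    (hδε : Γ ^ M * δ ≤ ε)
    (hM1 : Real.log 3 ≤ lam / 4 * M)
    (hp1 : M * Real.log (p + 1) * (δ + η) ≤ lam / 4) (n : ℕ) :
    volume (Bset f (Icc a b) lam δ n) ≤
      ENNReal.ofReal ((Real.exp (2 * (M * Real.log (p + 1))) * (b - a)) *
        Real.exp (-(lam / 2)) ^ n) := by
  rcases Nat.eq_zero_or_pos n with rfl | hn
  · have : Bset f (Icc a b) lam δ 0 = ∅ := by
      ext x
      simp [Bset, hlam.le]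
    rw [this]; simp
  have hn' : (0 : ℝ) < n := by exact_mod_cast hn
  have hlog : ∀ x ∈ Bset f (Icc a b) lam δ n, lam * n < Real.log |Dcomp f n x| := by
    intro x hx
    have := hx.2.2
    rwa [one_div, inv_mul_eq_div, lt_div_iff₀ hn'] at this
  have hne : ∀ x ∈ Bset f (Icc a b) lam δ n, Dcomp f n x ≠ 0 := by
    intro x hx h0
    have := hlog x hx
    rw [h0] at this
    simp at this
    nlinarith
  have hdiv := Nat.div_add_mod n M
  have hmod := Nat.mod_lt n hM
  set k := ⌊(δ + η) * n + 1⌋₊ with hk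
  have hkle : (k : ℝ) ≤ (δ + η) * n + 1 := Nat.floor_le (by positivity)
  have hcov0 : Cov f (n / M * M) (Bset f (Icc a b) lam δ n)
      (3 ^ (n / M) * ((p + 1) ^ M) ^ k) := by
    refine (Cov.count hC1 hmaps hΓ hbdd hcrit hε hδε (n / M) k).mono ?_ le_rfl
    intro x hx
    refine ⟨hx.1, Dcomp_ne_zero_mono (Nat.div_mul_le_self n M) (hne x hx), ?_⟩
    refine Nat.le_floor ?_
    refine bad_count hM hmaps hΓ hbdd hδ hη hζ hx.1 ?_ (hne x hx) ?_
    · have := hx.2.1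
      rw [one_div, inv_mul_eq_div, div_lt_iff₀ hn'] at this
      exact this.le
    · have := hlog x hx
      nlinarith
  have heq : n / M * M + n % M = n := Nat.div_add_mod' n M
  have hcov := Cov.steps hC1 hmaps hcrit hcov0 (fun x hx => hx.1) (n % M)
    (by rw [heq]; exact hne)
  rw [heq] at hcov
  have hmeas := hcov.measure hC1 hmaps (fun x hx => hx.1) (Real.exp_pos (lam * n))
    (fun x hx => by
      rw [← Real.le_log_iff_exp_le (abs_pos.2 (hne x hx))]
      exact (hlog x hx).le)
  refine hmeas.trans ?_
  rw [← ENNReal.ofReal_natCast, ← ENNReal.ofReal_mul (Nat.cast_nonneg _)]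
  refine ENNReal.ofReal_le_ofReal ?_
  have hba : 0 ≤ b - a := by linarith
  set L := Real.log ((p : ℝ) + 1) with hL
  have hp0 : (0 : ℝ) < (p : ℝ) + 1 := by positivity
  have hL0 : 0 ≤ L := Real.log_nonneg (by linarith [(Nat.cast_nonneg p : (0 : ℝ) ≤ p)])
  have hpe : (p : ℝ) + 1 = Real.exp L := (Real.exp_log hp0).symm
  have h3e : (3 : ℝ) = Real.exp (Real.log 3) := (Real.exp_log (by norm_num)).symm
  have hN : (((p + 1) ^ (n % M) * (3 ^ (n / M) * ((p + 1) ^ M) ^ k) : ℕ) : ℝ) ≤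
      Real.exp (2 * (M * L)) * Real.exp (lam / 2 * n) := by
    push_cast
    rw [hpe, h3e]
    simp only [← Real.exp_nat_mul, ← Real.exp_add]
    refine Real.exp_le_exp.2 ?_
    have e1 : ((n % M : ℕ) : ℝ) * L ≤ M * L := by gcongr
    have e2 : ((n / M : ℕ) : ℝ) * Real.log 3 ≤ lam / 4 * n := by
      have : ((n / M : ℕ) : ℝ) * M ≤ n := by exact_mod_cast Nat.div_mul_le_self n M
      have h0 : (0 : ℝ) ≤ ((n / M : ℕ) : ℝ) := Nat.cast_nonneg _
      nlinarith [mul_le_mul_of_nonneg_left hM1 h0]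
    have e3 : (k : ℝ) * (M * L) ≤ M * L + lam / 4 * n := by
      have hML : 0 ≤ M * L := by positivity
      nlinarith [mul_le_mul_of_nonneg_right hkle hML, mul_le_mul_of_nonneg_right hp1 hn'.le]
    nlinarith
  calc _ ≤ (Real.exp (2 * (M * L)) * Real.exp (lam / 2 * n)) * ((b - a) / Real.exp (lam * n)) := by
        gcongr
    _ = _ := by
        rw [← Real.exp_nat_mul, div_eq_mul_inv (b - a), ← Real.exp_neg]
        have : Real.exp (n * -(lam / 2)) = Real.exp (lam / 2 * n) * Real.exp (-(lam * n)) := by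
          rw [← Real.exp_add]; congr 1; ring
        rw [this]; ring

/-- Theorem B: if the Lyapunov exponent of the compositions exceeds `2λ`
on a set `H`, then for some `c > 0`, for Lebesgue-a.e. `x ∈ H`,
`liminf (1/n) Σ_{i=1}^n r_i(x) ≥ c`. -/
theorem theoremB_liminf_of_r_positive
    (a b Γ lam : ℝ) (hab : a ≤ b) (f : ℕ → ℝ → ℝ) (p : ℕ)
    (hC1 : ∀ k, ContDiff ℝ 1 (f k))
    (hmaps : ∀ k, MapsTo (f k) (Icc a b) (Icc a b))
    (hequi : ∀ ζ > (0 : ℝ), ∃ ε > (0 : ℝ), ∀ k, ∀ x ∈ Icc a b, ∀ y ∈ Icc a b,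
      |x - y| < ε → |f k x - f k y| < ζ ∧ |deriv (f k) x - deriv (f k) y| < ζ)
    (hbdd : ∀ k, ∀ x ∈ Icc a b, |f k x| ≤ Γ ∧ |deriv (f k) x| ≤ Γ)
    (hcrit : ∀ k, (crit f (Icc a b) k).Finite ∧ (crit f (Icc a b) k).ncard ≤ p)
    (hlam : 0 < lam) (H : Set ℝ) (hH : H ⊆ Icc a b)
    (hlyap : ∀ x ∈ H, 2 * lam <
      liminf (fun n : ℕ => (1 / (n : ℝ)) * Real.log |Dcomp f n x|) atTop) :
    ∃ c > (0 : ℝ), ∀ᵐ x ∂(volume.restrict H),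
      c ≤ liminf (fun n : ℕ =>
        (1 / (n : ℝ)) * ∑ i ∈ Finset.Icc 1 n, r f (Icc a b) i x) atTop := by
  set Γ' := max Γ 1 with hΓ'
  have hΓ1 : 1 ≤ Γ' := le_max_right _ _
  have hbdd' : ∀ k, ∀ x ∈ Icc a b, |deriv (f k) x| ≤ Γ' := fun k x hx =>
    (hbdd k x hx).2.trans (le_max_left _ _)
  -- choice of the parameters
  obtain ⟨M, hM0, hM1⟩ : ∃ M : ℕ, 0 < M ∧ Real.log 3 ≤ lam / 4 * M := by
    obtain ⟨M, hM⟩ := exists_nat_ge (Real.log 3 / (lam / 4))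
    refine ⟨M + 1, Nat.succ_pos _, ?_⟩
    rw [div_le_iff₀ (by positivity)] at hM
    push_cast
    nlinarith
  set Q := (M : ℝ) * Real.log (p + 1) with hQ
  have hQ0 : 0 ≤ Q := by
    have : 0 ≤ Real.log ((p : ℝ) + 1) :=
      Real.log_nonneg (by linarith [(Nat.cast_nonneg p : (0 : ℝ) ≤ p)])
    positivity
  set η := lam / 8 / (Q + 1) with hη
  have hη0 : 0 < η := by positivity
  have hQη : Q * η ≤ lam / 8 := by
    rw [hη, mul_div_assoc', div_le_iff₀ (by positivity)]
    nlinarith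
  obtain ⟨ε, hε0, hε⟩ := hequi (Real.exp (-((Real.log Γ' + 1) / η))) (Real.exp_pos _)
  have hΓM : 0 < Γ' ^ M := by positivity
  set δ := min η (ε / Γ' ^ M) with hδ
  have hδ0 : 0 < δ := lt_min hη0 (by positivity)
  have hδε : Γ' ^ M * δ ≤ ε := by
    have : δ ≤ ε / Γ' ^ M := min_le_right _ _
    rw [le_div_iff₀ hΓM] at this
    linarith
  have hQδ : Q * (δ + η) ≤ lam / 4 := by
    have h1 : δ ≤ η := min_le_left _ _
    nlinarith
  have hmeas := Bset_measure hM0 hab hC1 hlam hmaps hΓ1 hbdd' hcrit hδ0 hη0 rfl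
    (fun k x hx y hy hxy => (hε k x hx y hy hxy).2) hδε hM1 hQδ
  have hsum : ∑' n, volume (Bset f (Icc a b) lam δ n) ≠ ⊤ := by
    refine ne_top_of_le_ne_top ?_ (ENNReal.tsum_le_tsum hmeas)
    refine Summable.tsum_ofReal_ne_top ?_
    refine Summable.mul_left _ (summable_geometric_of_lt_one (Real.exp_pos _).le ?_)
    rw [Real.exp_lt_one_iff]
    linarith
  have hBC := ae_eventually_notMem hsum
  -- a measurable set containing `H`
  let H' : Set ℝ := {x | ∀ᶠ n : ℕ in atTop, lam < (1 / (n : ℝ)) * Real.log |Dcomp f n x|}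
  have hH'meas : MeasurableSet (Icc a b ∩ H') := by
    refine measurableSet_Icc.inter ?_
    have hrw : H' = ⋃ N : ℕ, ⋂ n : ℕ, ⋂ _ : N ≤ n,
        {x | lam < (1 / (n : ℝ)) * Real.log |Dcomp f n x|} := by
      ext x
      simp [H', eventually_atTop]
    rw [hrw]
    refine MeasurableSet.iUnion fun N => MeasurableSet.iInter fun n =>
      MeasurableSet.iInter fun _ => ?_
    exact measurableSet_lt measurable_const
      (((Dcomp_continuous hC1 n).abs.measurable.log).const_mul _)
  have hHH' : H ⊆ Icc a b ∩ H' := by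
    intro x hx
    refine ⟨hH hx, ?_⟩
    have h := hlyap x hx
    rw [liminf_eq] at h
    have hne : {c : ℝ | ∀ᶠ n : ℕ in atTop, c ≤ (1 / (n : ℝ)) * Real.log |Dcomp f n x|}.Nonempty := by
      by_contra hemp
      rw [Set.not_nonempty_iff_eq_empty.1 hemp, Real.sSup_empty] at h
      linarith
    obtain ⟨c, hc, hc2⟩ := exists_lt_of_lt_csSup hne h
    filter_upwards [hc] with n hn
    linarith
  refine ⟨δ ^ 2, by positivity, ?_⟩
  refine ae_restrict_of_ae_restrict_of_subset hHH' ?_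
  rw [ae_restrict_iff' hH'meas]
  filter_upwards [hBC] with x hx1 hx2
  refine le_liminf_of_le ?_ ?_
  · refine IsCoboundedUnder.of_frequently_le (a := b - a) (Eventually.frequently ?_)
    filter_upwards [eventually_gt_atTop 0] with n hn
    have hn' : (0 : ℝ) < n := by exact_mod_cast hn
    rw [one_div, inv_mul_eq_div, div_le_iff₀ hn']
    calc _ ≤ ∑ i ∈ Finset.Icc 1 n, (b - a) :=
          Finset.sum_le_sum fun i _ => r_le hab hmaps i x
      _ = _ := by simp; ring
  · filter_upwards [hx1, hx2.2] with n h1 h2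
    by_contra hlt
    exact h1 ⟨hx2.1, not_le.1 hlt, h2⟩
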